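/- arXiv:2003.12942 — 9 statements merged into one kernel-verified Lean document; each statement's English description precedes it below -/
import Mathlib

section
/- An n×n real matrix A is diagonalizable over the reals — i.e., there exist an invertible real matrix L and a real diagonal matrix Λ with L·A = Λ·L — if and only if there exists a symmetric positive definite real n×n matrix A₀ such that A₀·A = Aᵀ·A₀. -/
open Matrix

/-- An n×n real matrix `A` is diagonalizable over the reals (there exist an invertible real
matrix `L` and a real diagonal matrix `Λ = diagonal d` with `L * A = Λ * L`) if and only if
there exists a symmetric positive definite real matrix `A₀` with `A₀ * A = Aᵀ * A₀`. -/
theorem stmt0 (n : ℕ) (hn : 1 ≤ n) (A : Matrix (Fin n) (Fin n) ℝ) :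
    (∃ (L : Matrix (Fin n) (Fin n) ℝ) (d : Fin n → ℝ),
        IsUnit L ∧ L * A = diagonal d * L) ↔
    (∃ A₀ : Matrix (Fin n) (Fin n) ℝ, A₀ᵀ = A₀ ∧ A₀.PosDef ∧ A₀ * A = Aᵀ * A₀) := by
  constructor
  · rintro ⟨L, d, hL, h⟩
    refine ⟨Lᵀ * L, by simp, ?_, ?_⟩
    · have := PosDef.conjTranspose_mul_self L (mulVec_injective_of_isUnit hL)
      rwa [conjTranspose_eq_transpose_of_trivial] at this
    · have h2 := congrArg transpose h
      rw [transpose_mul, transpose_mul, diagonal_transpose] at h2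
      rw [Matrix.mul_assoc, h, ← Matrix.mul_assoc, ← h2, Matrix.mul_assoc]
  · rintro ⟨A₀, -, hpos, h⟩
    have hfac : ∃ B : Matrix (Fin n) (Fin n) ℝ, A₀ = Bᵀ * B := by
      open scoped MatrixOrder in
      obtain ⟨B, hB⟩ := CStarAlgebra.nonneg_iff_eq_star_mul_self.mp hpos.posSemidef.nonneg
      exact ⟨B, by rw [hB, star_eq_conjTranspose, conjTranspose_eq_transpose_of_trivial]⟩
    obtain ⟨B, rfl⟩ := hfac
    have hBu : IsUnit B := by
      have h1 := (isUnit_iff_isUnit_det _).mp hpos.isUnit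
      rw [det_mul] at h1
      exact (isUnit_iff_isUnit_det _).mpr (isUnit_of_mul_isUnit_right h1)
    have hdet := (isUnit_iff_isUnit_det _).mp hBu
    have hBC : B * B⁻¹ = 1 := mul_nonsing_inv B hdet
    have hCB : B⁻¹ * B = 1 := nonsing_inv_mul B hdet
    have hCBt : (B⁻¹)ᵀ * Bᵀ = 1 := by rw [← transpose_mul, hBC, transpose_one]
    have hS : (B * A * B⁻¹).IsHermitian := by
      rw [IsHermitian, conjTranspose_eq_transpose_of_trivial, transpose_mul, transpose_mul]
      calc (B⁻¹)ᵀ * (Aᵀ * Bᵀ) = (B⁻¹)ᵀ * (Aᵀ * (Bᵀ * B)) * B⁻¹ := by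
            simp only [Matrix.mul_assoc, hBC, Matrix.mul_one]
        _ = ((B⁻¹)ᵀ * Bᵀ) * (B * A * B⁻¹) := by
            rw [← h]; simp only [Matrix.mul_assoc]
        _ = B * A * B⁻¹ := by rw [hCBt, Matrix.one_mul]
    have hsp := hS.spectral_theorem
    rw [Unitary.conjStarAlgAut_apply] at hsp
    have hU := Unitary.coe_star_mul_self hS.eigenvectorUnitary
    have hU' : IsUnit (star hS.eigenvectorUnitary : Matrix (Fin n) (Fin n) ℝ) :=
      IsUnit.of_mul_eq_one _ hU
    refine ⟨(star hS.eigenvectorUnitary : Matrix (Fin n) (Fin n) ℝ) * B, hS.eigenvalues,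
      hU'.mul hBu, ?_⟩
    generalize (hS.eigenvectorUnitary : Matrix (Fin n) (Fin n) ℝ) = U at *
    have hBA : B * A = (B * A * B⁻¹) * B := by
      rw [Matrix.mul_assoc (B * A), hCB, Matrix.mul_one]
    have hd : diagonal (RCLike.ofReal ∘ hS.eigenvalues) = diagonal hS.eigenvalues := by
      congr 1
    rw [hd] at hsp
    generalize hS.eigenvalues = d at *
    rw [Matrix.mul_assoc, hBA, hsp]
    simp only [← Matrix.mul_assoc]
    rw [hU, Matrix.one_mul]
end

section
/- Let A, A₀, L ∈ M_n(ℝ) and let Λ ∈ M_n(ℝ) be diagonal. Assume L is invertible, L·A = Λ·L, and A₀·A = Aᵀ·A₀. Then the matrix (L⁻¹)ᵀ·A₀·L⁻¹ commutes with Λ, i.e. (L⁻¹)ᵀA₀L⁻¹·Λ = Λ·(L⁻¹)ᵀA₀L⁻¹. -/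
open Matrix

/-- If `L` is invertible, `L * A = Λ * L` with `Λ = diagonal d` diagonal, and
`A₀ * A = Aᵀ * A₀`, then `(L⁻¹)ᵀ * A₀ * L⁻¹` commutes with `Λ`. -/
theorem stmt1 (n : ℕ) (A A₀ L : Matrix (Fin n) (Fin n) ℝ) (d : Fin n → ℝ)
    (hL : IsUnit L) (h1 : L * A = diagonal d * L) (h2 : A₀ * A = Aᵀ * A₀) :
    ((L⁻¹)ᵀ * A₀ * L⁻¹) * diagonal d = diagonal d * ((L⁻¹)ᵀ * A₀ * L⁻¹) := by
  have hdet : IsUnit L.det := (Matrix.isUnit_iff_isUnit_det L).mp hL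
  have k : L⁻¹ * diagonal d = A * L⁻¹ := by
    calc L⁻¹ * diagonal d = L⁻¹ * (diagonal d * L) * L⁻¹ := by
          rw [Matrix.mul_assoc, Matrix.mul_assoc, Matrix.mul_nonsing_inv _ hdet, Matrix.mul_one]
      _ = A * L⁻¹ := by
          rw [← h1, ← Matrix.mul_assoc, Matrix.nonsing_inv_mul _ hdet, Matrix.one_mul]
  have kt : diagonal d * (L⁻¹)ᵀ = (L⁻¹)ᵀ * Aᵀ := by
    have := congrArg Matrix.transpose k
    rwa [Matrix.transpose_mul, Matrix.transpose_mul, Matrix.diagonal_transpose] at this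
  calc ((L⁻¹)ᵀ * A₀ * L⁻¹) * diagonal d = (L⁻¹)ᵀ * (A₀ * A) * L⁻¹ := by
        rw [Matrix.mul_assoc, k]; simp only [Matrix.mul_assoc]
    _ = ((L⁻¹)ᵀ * Aᵀ) * A₀ * L⁻¹ := by rw [h2]; simp only [Matrix.mul_assoc]
    _ = diagonal d * ((L⁻¹)ᵀ * A₀ * L⁻¹) := by rw [← kt]; simp only [Matrix.mul_assoc]
end

section
/- Let 1 ≤ m < n, let Λ₋ = diag(λ₁, …, λ_m) with all λ_r < 0 and Λ₊ = diag(λ_{m+1}, …, λ_n) with all λ_s > 0, and let X₁ ∈ M_m(ℝ), X₂ ∈ M_{n−m}(ℝ) be symmetric positive definite with X₁Λ₋ = Λ₋X₁ and X₂Λ₊ = Λ₊X₂. Let κ₊, κ₋ ∈ ℝ satisfy κ₊² < exp(−max_{s} λ_s) and κ₋² < exp(min_{r} λ_r), and set K = diag(κ₊·I_{n−m}, κ₋·I_m) ∈ M_n(ℝ). Then both matrices G₁ = diag(X₂Λ₊, −X₁Λ₋) − Kᵀ·diag(X₂Λ₊, −X₁Λ₋)·K and G₂ = diag(e^{−Λ₊}Λ₊,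 −Λ₋) − Kᵀ·diag(Λ₊, −e^{−Λ₋}Λ₋)·K are symmetric positive definite, where e^{−Λ±} denotes the diagonal matrix with entries e^{−λᵢ}. -/
open Matrix

theorem aux_posDef_iff {ι : Type*} [Fintype ι] (A : Matrix ι ι ℝ) :
    A.PosDef ↔ Aᵀ = A ∧ ∀ x : ι → ℝ, x ≠ 0 → 0 < x ⬝ᵥ (A *ᵥ x) := by
  constructor
  · intro h
    refine ⟨by simpa [IsHermitian] using h.isHermitian, fun x hx => ?_⟩
    simpa using h.dotProduct_mulVec_pos hx
  · rintro ⟨h, h'⟩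
    refine PosDef.of_dotProduct_mulVec_pos (by simpa [IsHermitian] using h) fun x hx => ?_
    simpa using h' x hx

theorem aux_mul {ι : Type*} [Fintype ι] [DecidableEq ι] (X : Matrix ι ι ℝ) (d : ι → ℝ)
    (hd : ∀ i, 0 < d i) (hX : X.PosDef) (hc : X * diagonal d = diagonal d * X) :
    (X * diagonal d).PosDef := by
  rw [aux_posDef_iff] at hX ⊢
  obtain ⟨hs, hp⟩ := hX
  refine ⟨by rw [transpose_mul, diagonal_transpose, hs, hc], fun x hx => ?_⟩
  have key : x ⬝ᵥ ((X * diagonal d) *ᵥ x) =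
      (fun i => √(d i) * x i) ⬝ᵥ (X *ᵥ (fun i => √(d i) * x i)) := by
    simp only [dotProduct, mulVec, mul_diagonal]
    refine Finset.sum_congr rfl fun i _ => ?_
    rw [mul_assoc]
    rw [mul_left_comm (√(d i)) (x i)]
    congr 1
    rw [Finset.mul_sum]
    refine Finset.sum_congr rfl fun j _ => ?_
    have h := congrFun (congrFun hc i) j
    rw [mul_diagonal, diagonal_mul] at h
    by_cases h0 : X i j = 0
    · simp [h0]
    · have : d j = d i := by
        apply mul_left_cancel₀ h0
        rw [h, mul_comm]
      rw [this]
      have h2 := Real.mul_self_sqrt (hd i).le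
      linear_combination (-(X i j * x j)) * h2
  rw [key]
  apply hp
  intro h
  apply hx
  funext i
  have := congrFun h i
  simpa [(Real.sqrt_pos.2 (hd i)).ne'] using this

theorem aux_blocks {ι κ : Type*} [Fintype ι] [Fintype κ] (A : Matrix ι ι ℝ)
    (D : Matrix κ κ ℝ) (hA : A.PosDef) (hD : D.PosDef) : (fromBlocks A 0 0 D).PosDef := by
  have hA' := hA.posSemidef
  have hD' := hD.posSemidef
  have nA : ∀ x : ι → ℝ, 0 ≤ x ⬝ᵥ (A *ᵥ x) := fun x => by
    simpa using hA'.dotProduct_mulVec_nonneg x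
  have nD : ∀ x : κ → ℝ, 0 ≤ x ⬝ᵥ (D *ᵥ x) := fun x => by
    simpa using hD'.dotProduct_mulVec_nonneg x
  rw [aux_posDef_iff] at hA hD ⊢
  refine ⟨by simp [fromBlocks_transpose, hA.1, hD.1], fun x hx => ?_⟩
  have e : x ⬝ᵥ (fromBlocks A 0 0 D *ᵥ x) = (x ∘ Sum.inl) ⬝ᵥ (A *ᵥ (x ∘ Sum.inl))
      + (x ∘ Sum.inr) ⬝ᵥ (D *ᵥ (x ∘ Sum.inr)) := by
    rw [fromBlocks_mulVec]
    simp [dotProduct, Fintype.sum_sum_type]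
  rw [e]
  by_cases h : x ∘ Sum.inl = 0
  · have h2 : x ∘ Sum.inr ≠ 0 := by
      intro h2
      apply hx
      funext i
      rcases i with i | i
      · exact congrFun h i
      · exact congrFun h2 i
    exact add_pos_of_nonneg_of_pos (nA _) (hD.2 _ h2)
  · exact add_pos_of_pos_of_nonneg (hA.2 _ h) (nD _)

/-- Remark 1.3 (second part): with `Λ₋ = diagonal lamm` (negative entries, size `m`),
`Λ₊ = diagonal lamp` (positive entries, size `k = n − m ≥ 1`), `X₁, X₂` symmetric positive
definite commuting with `Λ₋, Λ₊` respectively, and the diagonal feedback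
`K = diag(κ₊ I_{n−m}, κ₋ I_m)` with `κ₊² < exp(−max_s λ_s)` and `κ₋² < exp(min_r λ_r)`
(equivalently `κ₊² < exp(−λ_s)` for all `s` and `κ₋² < exp(λ_r)` for all `r`), both
matrices `G₁` and `G₂` of (1.21)–(1.22) are symmetric positive definite. -/
theorem stmt5 (m k : ℕ) (hm : 1 ≤ m) (hk : 1 ≤ k)
    (lamm : Fin m → ℝ) (lamp : Fin k → ℝ)
    (hneg : ∀ i, lamm i < 0) (hpos : ∀ j, 0 < lamp j)
    (X₁ : Matrix (Fin m) (Fin m) ℝ) (X₂ : Matrix (Fin k) (Fin k) ℝ)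
    (hX₁s : X₁ᵀ = X₁) (hX₂s : X₂ᵀ = X₂)
    (hX₁ : X₁.PosDef) (hX₂ : X₂.PosDef)
    (hc₁ : X₁ * diagonal lamm = diagonal lamm * X₁)
    (hc₂ : X₂ * diagonal lamp = diagonal lamp * X₂)
    (κp κm : ℝ)
    (hκp : ∀ s, κp ^ 2 < Real.exp (-lamp s))
    (hκm : ∀ r, κm ^ 2 < Real.exp (lamm r))
    (K : Matrix (Fin k ⊕ Fin m) (Fin k ⊕ Fin m) ℝ)
    (hK : K = fromBlocks (κp • (1 : Matrix (Fin k) (Fin k) ℝ)) 0 0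
        (κm • (1 : Matrix (Fin m) (Fin m) ℝ)))
    (G₁ G₂ : Matrix (Fin k ⊕ Fin m) (Fin k ⊕ Fin m) ℝ)
    (hG₁ : G₁ = fromBlocks (X₂ * diagonal lamp) 0 0 (-(X₁ * diagonal lamm))
        - Kᵀ * fromBlocks (X₂ * diagonal lamp) 0 0 (-(X₁ * diagonal lamm)) * K)
    (hG₂ : G₂ = fromBlocks (diagonal (fun s => Real.exp (-lamp s)) * diagonal lamp) 0 0
          (-(diagonal lamm))
        - Kᵀ * fromBlocks (diagonal lamp) 0 0
          (-(diagonal (fun r => Real.exp (-lamm r)) * diagonal lamm)) * K) :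
    G₁ᵀ = G₁ ∧ G₁.PosDef ∧ G₂ᵀ = G₂ ∧ G₂.PosDef := by
  have sym : ∀ G : Matrix (Fin k ⊕ Fin m) (Fin k ⊕ Fin m) ℝ, G.PosDef → Gᵀ = G ∧ G.PosDef :=
    fun G h => ⟨((aux_posDef_iff G).1 h).1, h⟩
  have h1 : κp ^ 2 < 1 := (hκp ⟨0, hk⟩).trans (by
    rw [Real.exp_lt_one_iff]; linarith [hpos ⟨0, hk⟩])
  have h2 : κm ^ 2 < 1 := (hκm ⟨0, hm⟩).trans (by
    rw [Real.exp_lt_one_iff]; exact hneg ⟨0, hm⟩)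
  have P2 := aux_mul X₂ lamp hpos hX₂ hc₂
  have P1 := aux_mul X₁ (-lamm) (fun i => by simpa using hneg i) hX₁ (by
    have : diagonal (-lamm) = -diagonal lamm := by rw [diagonal_neg]; rfl
    rw [this, mul_neg, neg_mul, hc₁])
  have E1 : G₁ = fromBlocks ((1 - κp ^ 2) • (X₂ * diagonal lamp)) 0 0
      ((1 - κm ^ 2) • (X₁ * diagonal (-lamm))) := by
    rw [hG₁, hK, fromBlocks_transpose, fromBlocks_multiply, fromBlocks_multiply]
    ext (i | i) (j | j) <;> simp [mul_diagonal] <;> ring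
  have E2 : G₂ = fromBlocks (diagonal fun s => (Real.exp (-lamp s) - κp ^ 2) * lamp s) 0 0
      (diagonal fun r => (1 - κm ^ 2 * Real.exp (-lamm r)) * (-lamm r)) := by
    rw [hG₂, hK, fromBlocks_transpose, fromBlocks_multiply, fromBlocks_multiply]
    ext (i | i) (j | j) <;> simp [diagonal_apply] <;> split_ifs <;> ring
  have Q1 : G₁.PosDef := by
    rw [E1]
    exact aux_blocks _ _ (P2.smul (sub_pos.2 h1)) (P1.smul (sub_pos.2 h2))
  have Q2 : G₂.PosDef := by
    rw [E2]
    refine aux_blocks _ _ (PosDef.diagonal fun s => ?_) (PosDef.diagonal fun r => ?_)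
    · exact mul_pos (sub_pos.2 (hκp s)) (hpos s)
    · refine mul_pos (sub_pos.2 ?_) (neg_pos.2 (hneg r))
      have := mul_lt_mul_of_pos_right (hκm r) (Real.exp_pos (-lamm r))
      rwa [← Real.exp_add, add_neg_cancel, Real.exp_zero] at this
  exact ⟨(sym _ Q1).1, Q1, (sym _ Q2).1, Q2⟩
end

section
/- Let g, a, H*, V* > 0 and let λ₁ ≤ λ₂ ≤ λ₃ be real numbers such that λ³ − 2V*λ² + (V*² − gaV*² − gH*)λ + gaV*³ = (λ − λ₁)(λ − λ₂)(λ − λ₃) as polynomials in λ (equivalently λ₁ + λ₂ + λ₃ = 2V*, λ₁λ₂ + λ₁λ₃ + λ₂λ₃ = V*² − gaV*² − gH*, and λ₁λ₂λ₃ = −gaV*³). Then λ₁ < 0 < λ₂ ≤ λ₃; in particular no λᵢ vanishes. -/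
/-- The sign assertion (5.7): if `g, a, H*, V* > 0` and `λ₁ ≤ λ₂ ≤ λ₃` are the roots of
the characteristic cubic `λ³ − 2V*λ² + (V*² − gaV*² − gH*)λ + gaV*³`, i.e. they satisfy
the Vieta relations (5.6), then `λ₁ < 0 < λ₂ ≤ λ₃`; in particular no `λᵢ` vanishes. -/
theorem stmt9 (g a Hs Vs : ℝ) (hg : 0 < g) (ha : 0 < a) (hH : 0 < Hs) (hV : 0 < Vs)
    (l₁ l₂ l₃ : ℝ) (h12 : l₁ ≤ l₂) (h23 : l₂ ≤ l₃)
    (hsum : l₁ + l₂ + l₃ = 2 * Vs)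
    (hsum2 : l₁ * l₂ + l₁ * l₃ + l₂ * l₃ = Vs ^ 2 - g * a * Vs ^ 2 - g * Hs)
    (hprod : l₁ * l₂ * l₃ = -(g * a * Vs ^ 3)) :
    l₁ < 0 ∧ 0 < l₂ ∧ l₂ ≤ l₃ ∧ l₁ ≠ 0 ∧ l₂ ≠ 0 ∧ l₃ ≠ 0 := by
  have hneg : l₁ * l₂ * l₃ < 0 := by
    rw [hprod]
    have : 0 < g * a * Vs ^ 3 := by positivity
    linarith
  have h1 : l₁ < 0 := by
    by_contra h
    have h1 : 0 ≤ l₁ := not_lt.mp h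
    have h2 : 0 ≤ l₂ := h1.trans h12
    have h3 : 0 ≤ l₃ := h2.trans h23
    have := mul_nonneg (mul_nonneg h1 h2) h3
    linarith
  have h2 : 0 < l₂ := by
    by_contra h
    have h2 : l₂ ≤ 0 := not_lt.mp h
    have h3 : 0 ≤ l₃ := by linarith
    have := mul_nonneg (mul_nonneg_of_nonpos_of_nonpos h1.le h2) h3
    linarith
  exact ⟨h1, h2, h23, h1.ne, h2.ne', (h2.trans_le h23).ne'⟩
end

section
/- Let g, a, H*, V* > 0 and let λ₁, λ₂, λ₃ be real numbers with λ₁ + λ₂ + λ₃ = 2V*, λ₁λ₂ + λ₁λ₃ + λ₂λ₃ = V*² − gaV*² − gH*, and λ₁λ₂λ₃ = −gaV*³. Let A₀ = [[(4gH* + 2agV*²)/(4H*²), −g/(2H*), −V*/(2H*)], [−g/(2H*), 3g/(2aV*²), 0], [−V*/(2H*), 0, 1]]. Then det(A₀) = (g/(aH*²V*³))·(λ₁ − (3/2)V*)(λ₂ − (3/2)V*)(λ₃ − (3/2)V*). -/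
open Matrix

/-- The determinant identity (5.20): with the Vieta relations (5.6) for the eigenvalues
`λ₁, λ₂, λ₃` of `𝐀(0)`, the determinant of the symmetrizer `A₀ = 𝐀₀(0)` equals
`(g/(aH*²V*³)) ∏ᵢ (λᵢ − (3/2)V*)`. -/
theorem stmt11 (g a Hs Vs : ℝ) (hg : 0 < g) (ha : 0 < a) (hH : 0 < Hs) (hV : 0 < Vs)
    (l₁ l₂ l₃ : ℝ)
    (hsum : l₁ + l₂ + l₃ = 2 * Vs)
    (hsum2 : l₁ * l₂ + l₁ * l₃ + l₂ * l₃ = Vs ^ 2 - g * a * Vs ^ 2 - g * Hs)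
    (hprod : l₁ * l₂ * l₃ = -(g * a * Vs ^ 3)) :
    (!![(4 * g * Hs + 2 * a * g * Vs ^ 2) / (4 * Hs ^ 2), -g / (2 * Hs), -Vs / (2 * Hs);
        -g / (2 * Hs), 3 * g / (2 * a * Vs ^ 2), 0;
        -Vs / (2 * Hs), 0, 1] : Matrix (Fin 3) (Fin 3) ℝ).det
      = g / (a * Hs ^ 2 * Vs ^ 3)
        * ((l₁ - 3 / 2 * Vs) * (l₂ - 3 / 2 * Vs) * (l₃ - 3 / 2 * Vs)) := by
  have key : (l₁ - 3 / 2 * Vs) * (l₂ - 3 / 2 * Vs) * (l₃ - 3 / 2 * Vs)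
      = -(3 / 8) * Vs ^ 3 + g * a * Vs ^ 3 / 2 + 3 / 2 * g * Hs * Vs := by
    linear_combination hprod - 3 / 2 * Vs * hsum2 + 9 / 4 * Vs ^ 2 * hsum
  rw [key, Matrix.det_fin_three]
  simp
  field_simp
  ring
end

section
/- Let g, a, H*, V*, C_f > 0 and let λ₁ ≤ λ₂ ≤ λ₃ be real numbers such that λ³ − 2V*λ² + (V*² − gaV*² − gH*)λ + gaV*³ = (λ − λ₁)(λ − λ₂)(λ − λ₃) as polynomials in λ. Assume λ₂ < −λ₁ and 0 < λ₂ < (3/2)V*. Then the symmetric matrix A₀ = [[(4gH* + 2agV*²)/(4H*²), −g/(2H*), −V*/(2H*)], [−g/(2H*), 3g/(2aV*²), 0], [−V*/(2H*), 0, 1]] is positive definite. -/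
open Matrix

/-- Under the physical smallness assumptions (5.11) on the sediment characteristic speed
`λ₂`, the symmetric matrix `A₀ = 𝐀₀(0)` of (5.15) is positive definite
(combining (5.13), (5.20) and (5.21)). -/
theorem stmt12 (g a Hs Vs Cf : ℝ) (hg : 0 < g) (ha : 0 < a) (hH : 0 < Hs) (hV : 0 < Vs)
    (hCf : 0 < Cf)
    (l₁ l₂ l₃ : ℝ) (h12 : l₁ ≤ l₂) (h23 : l₂ ≤ l₃)
    (hfact : ∀ x : ℝ, x ^ 3 - 2 * Vs * x ^ 2 + (Vs ^ 2 - g * a * Vs ^ 2 - g * Hs) * x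
        + g * a * Vs ^ 3 = (x - l₁) * (x - l₂) * (x - l₃))
    (hsmall₁ : l₂ < -l₁) (hl₂pos : 0 < l₂) (hsmall₂ : l₂ < 3 / 2 * Vs) :
    (!![(4 * g * Hs + 2 * a * g * Vs ^ 2) / (4 * Hs ^ 2), -g / (2 * Hs), -Vs / (2 * Hs);
        -g / (2 * Hs), 3 * g / (2 * a * Vs ^ 2), 0;
        -Vs / (2 * Hs), 0, 1] : Matrix (Fin 3) (Fin 3) ℝ).PosDef := by
  have e0 := hfact 0
  have e1 := hfact 1
  have e2 := hfact (-1)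
  have hs : l₁ + l₂ + l₃ = 2 * Vs := by linarith
  have hc : Vs ^ 2 - g * a * Vs ^ 2 - g * Hs = l₁ * l₂ + l₁ * l₃ + l₂ * l₃ := by linarith
  have hd : g * a * Vs ^ 3 = - (l₁ * l₂ * l₃) := by linarith
  have hl3 : 2 * Vs < l₃ := by linarith
  have hq : 2 * Vs * l₂ < -l₁ * l₃ := by nlinarith
  have hVl : 0 < Vs * l₂ := mul_pos hV hl₂pos
  have key : 0 < (3 * Vs - 2 * l₂) * (Vs * (Vs - 2 * l₂) + 4 / 3 * (-l₁ * l₃)) := by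
    apply mul_pos
    · linarith
    · nlinarith [mul_pos hV hV]
  have hl1 : l₁ = 2 * Vs - l₂ - l₃ := by linarith
  have hD : 0 < 4 * g * Hs + 4 / 3 * a * g * Vs ^ 2 - Vs ^ 2 := by
    refine pos_of_mul_pos_right (a := Vs) ?_ hV.le
    have : Vs * (4 * g * Hs + 4 / 3 * a * g * Vs ^ 2 - Vs ^ 2)
        = (3 * Vs - 2 * l₂) * (Vs * (Vs - 2 * l₂) + 4 / 3 * (-l₁ * l₃)) := by
      subst hl1
      linear_combination (-4 * Vs) * hc - 8 / 3 * hd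
    rw [this]; exact key
  rw [Matrix.posDef_iff_dotProduct_mulVec]
  refine ⟨?_, ?_⟩
  · ext i j
    fin_cases i <;> fin_cases j <;> simp
  · intro v hv
    have hform : star v ⬝ᵥ (!![(4 * g * Hs + 2 * a * g * Vs ^ 2) / (4 * Hs ^ 2), -g / (2 * Hs),
        -Vs / (2 * Hs);
        -g / (2 * Hs), 3 * g / (2 * a * Vs ^ 2), 0;
        -Vs / (2 * Hs), 0, 1] : Matrix (Fin 3) (Fin 3) ℝ) *ᵥ v
        = (v 2 - Vs / (2 * Hs) * v 0) ^ 2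
          + 3 * g / (2 * a * Vs ^ 2) * (v 1 - a * Vs ^ 2 / (3 * Hs) * v 0) ^ 2
          + (4 * g * Hs + 4 / 3 * a * g * Vs ^ 2 - Vs ^ 2) / (4 * Hs ^ 2) * (v 0) ^ 2 := by
      simp [dotProduct, Matrix.mulVec, Fin.sum_univ_three]
      field_simp
      ring
    rw [hform]
    have hB : 0 < 3 * g / (2 * a * Vs ^ 2) := by positivity
    have hE : 0 < (4 * g * Hs + 4 / 3 * a * g * Vs ^ 2 - Vs ^ 2) / (4 * Hs ^ 2) := by positivity
    by_cases h0 : v 0 = 0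
    · by_cases h1 : v 1 = 0
      · have h2 : v 2 ≠ 0 := by
          intro h2
          apply hv
          ext i
          fin_cases i <;> simp [h0, h1, h2]
        simp only [h0, h1]
        simp
        positivity
      · simp only [h0]
        simp
        positivity
    · positivity
end

section
/- Let g, a, H*, V*, C_f be real numbers with a ≠ 0, H* ≠ 0, V* ≠ 0. Let P = [[1, 0, 0], [0, 1, 0], [−V*/(2H*), 0, 1]], Q' = [[0, 0, 0], [0, 0, 0], [C_fV*²/H*², 0, −2C_fV*/H*]], and A₀ = [[(4gH* + 2agV*²)/(4H*²), −g/(2H*), −V*/(2H*)], [−g/(2H*), 3g/(2aV*²), 0], [−V*/(2H*), 0, 1]]. Then (P⁻¹)ᵀ·(A₀·Q' + (Q')ᵀ·A₀)·P⁻¹ = diag(0, 0, −4C_fV*/H*). -/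
open Matrix

/-- The computation (5.24): the congruence transform by `P⁻¹` of
`A₀ Q' + Q'ᵀ A₀` (with `A₀ = 𝐀₀(0)`, `Q' = 𝐐_U(0)`, `P = 𝐏(0)` the explicit matrices of
Section 5) equals the negative semidefinite diagonal matrix `diag(0, 0, −4C_f V*/H*)`. -/
theorem stmt15 (g a Hs Vs Cf : ℝ) (ha : a ≠ 0) (hH : Hs ≠ 0) (hV : Vs ≠ 0) :
    ((!![1, 0, 0; 0, 1, 0; -Vs / (2 * Hs), 0, 1] : Matrix (Fin 3) (Fin 3) ℝ)⁻¹)ᵀ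
        * ((!![(4 * g * Hs + 2 * a * g * Vs ^ 2) / (4 * Hs ^ 2), -g / (2 * Hs),
              -Vs / (2 * Hs);
              -g / (2 * Hs), 3 * g / (2 * a * Vs ^ 2), 0;
              -Vs / (2 * Hs), 0, 1] : Matrix (Fin 3) (Fin 3) ℝ)
            * !![0, 0, 0; 0, 0, 0; Cf * Vs ^ 2 / Hs ^ 2, 0, -2 * Cf * Vs / Hs]
          + (!![0, 0, 0; 0, 0, 0;
              Cf * Vs ^ 2 / Hs ^ 2, 0, -2 * Cf * Vs / Hs] : Matrix (Fin 3) (Fin 3) ℝ)ᵀ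
            * !![(4 * g * Hs + 2 * a * g * Vs ^ 2) / (4 * Hs ^ 2), -g / (2 * Hs),
              -Vs / (2 * Hs);
              -g / (2 * Hs), 3 * g / (2 * a * Vs ^ 2), 0;
              -Vs / (2 * Hs), 0, 1])
        * (!![1, 0, 0; 0, 1, 0; -Vs / (2 * Hs), 0, 1] : Matrix (Fin 3) (Fin 3) ℝ)⁻¹
      = diagonal ![0, 0, -4 * Cf * Vs / Hs] := by
  have hP : (!![1, 0, 0; 0, 1, 0; -Vs / (2 * Hs), 0, 1] : Matrix (Fin 3) (Fin 3) ℝ)⁻¹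
      = !![1, 0, 0; 0, 1, 0; Vs / (2 * Hs), 0, 1] := by
    apply Matrix.inv_eq_right_inv
    ext i j
    fin_cases i <;> fin_cases j <;>
      simp [Matrix.mul_apply, Fin.sum_univ_three, Matrix.one_apply] <;> ring
  rw [hP]
  ext i j
  fin_cases i <;> fin_cases j <;>
    simp [Matrix.mul_apply, Fin.sum_univ_three, Matrix.diagonal_apply] <;> field_simp <;> ring
end

section
/- Let g, a, H*, V* be real numbers and let λ₁, λ₂, λ₃ be pairwise distinct real numbers, each nonzero and different from V*, such that λ³ − 2V*λ² + (V*² − gaV*² − gH*)λ + gaV*³ = (λ − λ₁)(λ − λ₂)(λ − λ₃) as polynomials in λ. Let L ∈ M₃(ℝ) be the matrix with rows (g/(λᵢ − V*), g/λᵢ, 1) for i = 1, 2, 3, and let N ∈ M₃(ℝ) be the matrix whose i-th column is (λᵢH*, aV*²(λᵢ − V*), λᵢ(λᵢ − V*))ᵀ / ∏_{k≠i}(λᵢ − λₖ). Then L·N = I and N·L = I, i.e. L is invertible with L⁻¹ = N. -/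
open Matrix

theorem off_aux (g a H V x y z D : ℝ) (hx : x ≠ 0) (hV : x ≠ V)
    (e1 : 2 * V = x + y + z) (e2 : g * H + g * a * V ^ 2 = V ^ 2 - (x * y + x * z + y * z))
    (e3 : g * a * V ^ 3 = -(x * y * z)) :
    g / (x - V) * (y * H / D) + g / x * (a * V ^ 2 * (y - V) / D) + y * (y - V) / D = 0 := by
  have hV' : x - V ≠ 0 := sub_ne_zero.mpr hV
  have key : g / (x - V) * (y * H) + g / x * (a * V ^ 2 * (y - V)) + y * (y - V) = 0 := by
    field_simp
    linear_combination x * y * e2 + (V - x - y) * e3 + x * y * V * e1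
  linear_combination key / D

theorem diag_aux (g a H V x y z : ℝ) (hx : x ≠ 0) (hV : x ≠ V) (hy : x ≠ y) (hz : x ≠ z)
    (e1 : 2 * V = x + y + z) (e2 : g * H + g * a * V ^ 2 = V ^ 2 - (x * y + x * z + y * z))
    (e3 : g * a * V ^ 3 = -(x * y * z)) :
    g / (x - V) * (x * H / ((x - y) * (x - z)))
      + g / x * (a * V ^ 2 * (x - V) / ((x - y) * (x - z)))
      + x * (x - V) / ((x - y) * (x - z)) = 1 := by
  have hV' : x - V ≠ 0 := sub_ne_zero.mpr hV
  have hD : (x - y) * (x - z) ≠ 0 := mul_ne_zero (sub_ne_zero.mpr hy) (sub_ne_zero.mpr hz)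
  have key : g / (x - V) * (x * H) + g / x * (a * V ^ 2 * (x - V)) + x * (x - V)
      = (x - y) * (x - z) := by
    field_simp
    linear_combination x ^ 2 * e2 + (V - 2 * x) * e3 + x ^ 2 * V * e1
  have h2 := div_self hD
  linear_combination key / ((x - y) * (x - z)) + h2

/-- The explicit inverse formula (5.27): with `λ₁, λ₂, λ₃` the distinct real roots of the
characteristic cubic (5.5), each nonzero and different from `V*`, the matrix `L = 𝐋(0)`
of left eigenvectors is invertible with inverse the matrix `N` whose `i`-th column is
`(λᵢH*, aV*²(λᵢ − V*), λᵢ(λᵢ − V*))ᵀ / ∏_{k≠i}(λᵢ − λₖ)`. -/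
theorem stmt17 (g a Hs Vs : ℝ) (l₁ l₂ l₃ : ℝ)
    (h12 : l₁ ≠ l₂) (h13 : l₁ ≠ l₃) (h23 : l₂ ≠ l₃)
    (h1 : l₁ ≠ 0) (h2 : l₂ ≠ 0) (h3 : l₃ ≠ 0)
    (hV1 : l₁ ≠ Vs) (hV2 : l₂ ≠ Vs) (hV3 : l₃ ≠ Vs)
    (hfact : ∀ x : ℝ, x ^ 3 - 2 * Vs * x ^ 2 + (Vs ^ 2 - g * a * Vs ^ 2 - g * Hs) * x
        + g * a * Vs ^ 3 = (x - l₁) * (x - l₂) * (x - l₃))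
    (L N : Matrix (Fin 3) (Fin 3) ℝ)
    (hL : L = !![g / (l₁ - Vs), g / l₁, 1;
                 g / (l₂ - Vs), g / l₂, 1;
                 g / (l₃ - Vs), g / l₃, 1])
    (hN : N = !![l₁ * Hs / ((l₁ - l₂) * (l₁ - l₃)),
                 l₂ * Hs / ((l₂ - l₁) * (l₂ - l₃)),
                 l₃ * Hs / ((l₃ - l₁) * (l₃ - l₂));
                 a * Vs ^ 2 * (l₁ - Vs) / ((l₁ - l₂) * (l₁ - l₃)),
                 a * Vs ^ 2 * (l₂ - Vs) / ((l₂ - l₁) * (l₂ - l₃)),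
                 a * Vs ^ 2 * (l₃ - Vs) / ((l₃ - l₁) * (l₃ - l₂));
                 l₁ * (l₁ - Vs) / ((l₁ - l₂) * (l₁ - l₃)),
                 l₂ * (l₂ - Vs) / ((l₂ - l₁) * (l₂ - l₃)),
                 l₃ * (l₃ - Vs) / ((l₃ - l₁) * (l₃ - l₂))]) :
    L * N = 1 ∧ N * L = 1 := by
  have f0 := hfact 0
  have f1 := hfact 1
  have f2 := hfact (-1)
  have e3 : g * a * Vs ^ 3 = -(l₁ * l₂ * l₃) := by linear_combination f0
  have e1 : 2 * Vs = l₁ + l₂ + l₃ := by linear_combination f0 - (f1 + f2) / 2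
  have e2 : g * Hs + g * a * Vs ^ 2 = Vs ^ 2 - (l₁ * l₂ + l₁ * l₃ + l₂ * l₃) := by
    linear_combination (f2 - f1) / 2
  have main : L * N = 1 := by
    subst hL hN
    ext i j
    fin_cases i <;> fin_cases j <;>
      simp only [Matrix.mul_apply, Fin.sum_univ_three] <;> simp
    · exact diag_aux g a Hs Vs l₁ l₂ l₃ h1 hV1 h12 h13
        (by linear_combination e1) (by linear_combination e2) (by linear_combination e3)
    · exact off_aux g a Hs Vs l₁ l₂ l₃ _ h1 hV1 (by linear_combination e1) (by linear_combination e2) (by linear_combination e3)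
    · exact off_aux g a Hs Vs l₁ l₃ l₂ _ h1 hV1 (by linear_combination e1) (by linear_combination e2) (by linear_combination e3)
    · exact off_aux g a Hs Vs l₂ l₁ l₃ _ h2 hV2 (by linear_combination e1) (by linear_combination e2) (by linear_combination e3)
    · exact diag_aux g a Hs Vs l₂ l₁ l₃ h2 hV2 h12.symm h23
        (by linear_combination e1) (by linear_combination e2) (by linear_combination e3)
    · exact off_aux g a Hs Vs l₂ l₃ l₁ _ h2 hV2 (by linear_combination e1) (by linear_combination e2) (by linear_combination e3)
    · exact off_aux g a Hs Vs l₃ l₁ l₂ _ h3 hV3 (by linear_combination e1) (by linear_combination e2) (by linear_combination e3)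
    · exact off_aux g a Hs Vs l₃ l₂ l₁ _ h3 hV3 (by linear_combination e1) (by linear_combination e2) (by linear_combination e3)
    · exact diag_aux g a Hs Vs l₃ l₁ l₂ h3 hV3 h13.symm h23.symm
        (by linear_combination e1) (by linear_combination e2) (by linear_combination e3)
  exact ⟨main, mul_eq_one_comm.mp main⟩
end

section
/- Let g, a, H*, V* be real numbers with a ≠ 0, H* ≠ 0, V* ≠ 0, and let λ₁, λ₂, λ₃ be pairwise distinct real numbers, each nonzero and different from V*, such that λ³ − 2V*λ² + (V*² − gaV*² − gH*)λ + gaV*³ = (λ − λ₁)(λ − λ₂)(λ − λ₃) as polynomials in λ. Let L ∈ M₃(ℝ) be the matrix with rows (g/(λᵢ − V*), g/λᵢ, 1), and let A₀ = [[(4gH* + 2agV*²)/(4H*²), −g/(2H*), −V*/(2H*)], [−g/(2H*), 3g/(2aV*²), 0], [−V*/(2H*), 0, 1]]. Then (L⁻¹)ᵀ·A₀·L⁻¹ is the diagonal matrix diag(X₁₁, X₂₂, X₃₃) with X_{jj} = λⱼ(λⱼ − (3/2)V*) / ∏_{k≠j}(λⱼ − λₖ) for j = 1, 2, 3. -/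
open Matrix

/-- The diagonalization (5.28)–(5.29): with `L = 𝐋(0)` the matrix of left eigenvectors
and `A₀ = 𝐀₀(0)` the explicit symmetrizer, the congruence transform `(L⁻¹)ᵀ A₀ L⁻¹` is
the diagonal matrix with entries `X_jj = λⱼ(λⱼ − (3/2)V*) / ∏_{k≠j}(λⱼ − λₖ)`. -/
theorem stmt18 (g a Hs Vs : ℝ) (ha : a ≠ 0) (hH : Hs ≠ 0) (hV : Vs ≠ 0)
    (l₁ l₂ l₃ : ℝ)
    (h12 : l₁ ≠ l₂) (h13 : l₁ ≠ l₃) (h23 : l₂ ≠ l₃)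
    (h1 : l₁ ≠ 0) (h2 : l₂ ≠ 0) (h3 : l₃ ≠ 0)
    (hV1 : l₁ ≠ Vs) (hV2 : l₂ ≠ Vs) (hV3 : l₃ ≠ Vs)
    (hfact : ∀ x : ℝ, x ^ 3 - 2 * Vs * x ^ 2 + (Vs ^ 2 - g * a * Vs ^ 2 - g * Hs) * x
        + g * a * Vs ^ 3 = (x - l₁) * (x - l₂) * (x - l₃))
    (L : Matrix (Fin 3) (Fin 3) ℝ)
    (hL : L = !![g / (l₁ - Vs), g / l₁, 1;
                 g / (l₂ - Vs), g / l₂, 1;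
                 g / (l₃ - Vs), g / l₃, 1]) :
    (L⁻¹)ᵀ * !![(4 * g * Hs + 2 * a * g * Vs ^ 2) / (4 * Hs ^ 2), -g / (2 * Hs),
          -Vs / (2 * Hs);
          -g / (2 * Hs), 3 * g / (2 * a * Vs ^ 2), 0;
          -Vs / (2 * Hs), 0, 1] * L⁻¹
      = diagonal ![l₁ * (l₁ - 3 / 2 * Vs) / ((l₁ - l₂) * (l₁ - l₃)),
                   l₂ * (l₂ - 3 / 2 * Vs) / ((l₂ - l₁) * (l₂ - l₃)),
                   l₃ * (l₃ - 3 / 2 * Vs) / ((l₃ - l₁) * (l₃ - l₂))] := by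
  have e0 := hfact 0
  have eV := hfact Vs
  have e1 := hfact 1
  have em := hfact (-1)
  have hl3 : l₃ = 2 * Vs - l₁ - l₂ := by linarith
  have hga : g * a * Vs ^ 3 = -(l₁ * l₂ * l₃) := by linarith
  have hg : g ≠ 0 := by
    rintro rfl
    have : l₁ * l₂ * l₃ ≠ 0 := by positivity
    apply this
    linarith
  have hgH : g * Hs * Vs = (l₁ - Vs) * (l₂ - Vs) * (l₃ - Vs) := by linarith
  have ha' : a = -(l₁ * l₂ * l₃) / (g * Vs ^ 3) := by
    field_simp; linarith
  have hH' : Hs = (l₁ - Vs) * (l₂ - Vs) * (l₃ - Vs) / (g * Vs) := by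
    field_simp; linarith
  have d12 : l₁ - l₂ ≠ 0 := sub_ne_zero.2 h12
  have d13 : l₁ - l₃ ≠ 0 := sub_ne_zero.2 h13
  have d23 : l₂ - l₃ ≠ 0 := sub_ne_zero.2 h23
  have d21 : l₂ - l₁ ≠ 0 := sub_ne_zero.2 h12.symm
  have d31 : l₃ - l₁ ≠ 0 := sub_ne_zero.2 h13.symm
  have d32 : l₃ - l₂ ≠ 0 := sub_ne_zero.2 h23.symm
  have v1 : l₁ - Vs ≠ 0 := sub_ne_zero.2 hV1
  have v2 : l₂ - Vs ≠ 0 := sub_ne_zero.2 hV2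
  have v3 : l₃ - Vs ≠ 0 := sub_ne_zero.2 hV3
  have hdet : L.det = g ^ 2 * Vs * ((l₁ - l₂) * (l₁ - l₃) * (l₂ - l₃)) /
      (l₁ * l₂ * l₃ * ((l₁ - Vs) * (l₂ - Vs) * (l₃ - Vs))) * (-1) := by
    rw [hL, Matrix.det_fin_three]
    simp
    field_simp
    ring
  have hu : IsUnit L.det := by
    rw [isUnit_iff_ne_zero, hdet]
    exact mul_ne_zero (by positivity) (by norm_num)
  have key : !![(4 * g * Hs + 2 * a * g * Vs ^ 2) / (4 * Hs ^ 2), -g / (2 * Hs),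
          -Vs / (2 * Hs);
          -g / (2 * Hs), 3 * g / (2 * a * Vs ^ 2), 0;
          -Vs / (2 * Hs), 0, 1] = Lᵀ * diagonal ![l₁ * (l₁ - 3 / 2 * Vs) / ((l₁ - l₂) * (l₁ - l₃)),
                   l₂ * (l₂ - 3 / 2 * Vs) / ((l₂ - l₁) * (l₂ - l₃)),
                   l₃ * (l₃ - 3 / 2 * Vs) / ((l₃ - l₁) * (l₃ - l₂))] * L := by
    have r21 : l₂ - l₁ = -(l₁ - l₂) := by ring
    have r31 : l₃ - l₁ = -(l₁ - l₃) := by ring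
    have r32 : l₃ - l₂ = -(l₂ - l₃) := by ring
    rw [hL, ha', hH', r21, r31, r32]
    clear hdet hu hL e0 eV e1 em hfact hga hgH ha' hH' r21 r31 r32 d21 d31 d32
    ext i j
    fin_cases i <;> fin_cases j <;>
      simp [Matrix.mul_apply, Fin.sum_univ_three, Matrix.diagonal_apply] <;>
      field_simp <;> (try rw [hl3]) <;> ring
  rw [key]
  have hT : (L⁻¹)ᵀ * Lᵀ = 1 := by
    rw [← Matrix.transpose_mul, Matrix.mul_nonsing_inv _ hu, Matrix.transpose_one]
  rw [Matrix.mul_assoc, Matrix.mul_assoc, Matrix.mul_nonsing_inv _ hu, Matrix.mul_one,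
    ← Matrix.mul_assoc, hT, Matrix.one_mul]
end
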